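/- Let $N \ge 1$ be an integer and let $\tau:\{1,\dots,N+1\}\to\{0,1,2,\dots\}$ be a function, extended by $\tau(0)=0$, with $\tau(1)=0$ and $\tau(n+1)\le\tau(n)+1$ for all $1\le n\le N$. Then $\tau(n)<n$ for $1\le n\le N+1$; write $\tau^m$ for the $m$-th iterate and let $\operatorname{ord}(n)\ge 1$ be the least integer $m$ with $\tau^m(n)=0$. Suppose that $\tau$ is admissible, that is, that in addition the following hold for all $1\le n\le N$: (C) for every $0<k<\operatorname{ord}(n)$, if $\tau(n+1)<\tau^k(n)+1$, then $\tau(n+1)\le\tau^{k+1}(n)+1$; (D) for every $0<k<\operatorname{ord}(n)$, if $\tau(n+1)<\tau^k(n)+1$ and $\tau(\tau^k(n)+1)=\tau^{k+1}(n)+1$, then $\tau(n+1)<\tau^{k+1}(n)+1$; (E) if $\operatorname{ord}(n)>1$ and $\operatorname{ord}\bigl(\tau^{\operatorname{ord}(n)-1}(n)+1\bigr)=1$, then $\tau(n+1)\ne 0$. Then either $\tau(N+1)=0$ or $\tau(N+1)=\tau^k(N)+1$ for some integer $1\le k\le\operatorname{ord}(N)$. -/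

import Mathlib

/-- The order of `n` under `τ`: the least `m` with `τ^m(n) = 0`. Under (A), (B) and `τ 0 = 0`
such an `m` exists for every `n` in the domain, and it is at least `1` when `n ≥ 1`. -/
noncomputable def ordOf (τ : ℕ → ℕ) (n : ℕ) : ℕ := sInf {m | τ^[m] n = 0}

/-- Property (A): `τ(1) = 0`. -/
def PropA (τ : ℕ → ℕ) : Prop := τ 1 = 0

/-- Property (B): `τ(n+1) ≤ τ(n) + 1` for all `1 ≤ n ≤ N - 1`. -/
def PropB (N : ℕ) (τ : ℕ → ℕ) : Prop :=
  ∀ n, 1 ≤ n → n + 1 ≤ N → τ (n + 1) ≤ τ n + 1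

/-- Property (C): if `τ(n+1) < τ^k(n) + 1` for some `0 < k < ord(n)`, then
`τ(n+1) ≤ τ^{k+1}(n) + 1`. -/
def PropC (N : ℕ) (τ : ℕ → ℕ) : Prop :=
  ∀ n, 1 ≤ n → n + 1 ≤ N → ∀ k, 0 < k → k < ordOf τ n →
    τ (n + 1) < τ^[k] n + 1 → τ (n + 1) ≤ τ^[k + 1] n + 1

/-- Property (D): if `τ(n+1) < τ^k(n) + 1` for some `0 < k < ord(n)`, and
`τ(τ^k(n)+1) = τ^{k+1}(n)+1`, then `τ(n+1) < τ^{k+1}(n) + 1`. -/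
def PropD (N : ℕ) (τ : ℕ → ℕ) : Prop :=
  ∀ n, 1 ≤ n → n + 1 ≤ N → ∀ k, 0 < k → k < ordOf τ n →
    τ (n + 1) < τ^[k] n + 1 → τ (τ^[k] n + 1) = τ^[k + 1] n + 1 →
      τ (n + 1) < τ^[k + 1] n + 1

/-- Property (E): if `ord(n) > 1` and `ord(τ^{ord(n)-1}(n) + 1) = 1`, then `τ(n+1) ≠ 0`. -/
def PropE (N : ℕ) (τ : ℕ → ℕ) : Prop :=
  ∀ n, 1 ≤ n → n + 1 ≤ N → 1 < ordOf τ n →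
    ordOf τ (τ^[ordOf τ n - 1] n + 1) = 1 → τ (n + 1) ≠ 0

/-- `τ` restricts to an admissible τ-function of length `N`: it satisfies (A)–(E) on the domain
`{1, …, N}`, with the convention `τ 0 = 0`. Since `τ(n) < n` on the domain, no condition
involves the values of `τ` outside `{0, 1, …, N}` (for `N ≥ 1`); these are arbitrary. -/
def Admissible (N : ℕ) (τ : ℕ → ℕ) : Prop :=
  τ 0 = 0 ∧ PropA τ ∧ PropB N τ ∧ PropC N τ ∧ PropD N τ ∧ PropE N τ

/-- Under (A) and (B), `τ n < n` on the domain. -/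
theorem PropB.apply_lt {N : ℕ} {τ : ℕ → ℕ} (hA : PropA τ) (hB : PropB N τ) :
    ∀ n, 1 ≤ n → n ≤ N → τ n < n := by
  intro n hn
  induction n, hn using Nat.le_induction with
  | base => intro _; rw [show τ 1 = 0 from hA]; exact Nat.one_pos
  | succ n hn ih =>
    intro h
    have h₁ := ih (by omega)
    have h₂ := hB n hn h
    omega

/-- If `τ` decreases strictly on `{1, …, N}`, some iterate sends `n ≤ N` to `0`. -/
theorem exists_iterate_eq_zero {N : ℕ} {τ : ℕ → ℕ}
    (hlt : ∀ n, 1 ≤ n → n ≤ N → τ n < n) (n : ℕ) (hn : n ≤ N) : ∃ m, τ^[m] n = 0 := by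
  induction n using Nat.strong_induction_on with
  | _ n ih =>
    rcases Nat.eq_zero_or_pos n with rfl | hpos
    · exact ⟨0, rfl⟩
    · have h := hlt n hpos hn
      obtain ⟨m, hm⟩ := ih (τ n) h (by omega)
      exact ⟨m + 1, by rwa [Function.iterate_succ_apply]⟩

/-- The iterate of order `ordOf τ n` vanishes as soon as some iterate does. -/
theorem iterate_ordOf {τ : ℕ → ℕ} {n : ℕ} (h : ∃ m, τ^[m] n = 0) : τ^[ordOf τ n] n = 0 :=
  Nat.sInf_mem (s := {m | τ^[m] n = 0}) h

/-- For an admissible τ-function of length `N + 1`, either `τ(N+1) = 0` or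
`τ(N+1) = τ^k(N) + 1` for some `1 ≤ k ≤ ord(N)`. -/
theorem tau_succ_is_orbit_value (N : ℕ) (hN : 1 ≤ N) (τ : ℕ → ℕ)
    (hadm : Admissible (N + 1) τ) :
    τ (N + 1) = 0 ∨ ∃ k : ℕ, 1 ≤ k ∧ k ≤ ordOf τ N ∧ τ (N + 1) = τ^[k] N + 1 := by
  obtain ⟨-, hA, hB, hC, -, -⟩ := hadm
  have hzero : τ^[ordOf τ N] N = 0 :=
    iterate_ordOf (exists_iterate_eq_zero (hB.apply_lt hA) N N.le_succ)
  have hord : 1 ≤ ordOf τ N := by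
    by_contra h
    rw [show ordOf τ N = 0 by omega, Function.iterate_zero_apply] at hzero
    omega
  by_contra! hne
  obtain ⟨hpos, hne⟩ := hne
  have key : ∀ k, 1 ≤ k → k ≤ ordOf τ N → τ (N + 1) < τ^[k] N + 1 := by
    intro k hk
    induction k, hk using Nat.le_induction with
    | base => intro h; exact lt_of_le_of_ne (hB N hN le_rfl) (hne 1 le_rfl h)
    | succ k hk ih =>
      intro h
      exact lt_of_le_of_ne (hC N hN le_rfl k hk h (ih (by omega))) (hne (k + 1) (by omega) h)
  have := key _ hord le_rfl
  omega
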